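/- Fix y ≠ 0. The arrested-topographic-wave kernel (the λ = 1/2 interface condition arising in coastal upwelling, with transmission parameter α^# := √D⁻/(√D⁺+√D⁻)) has a continuously matching derivative across the interface: for every t > 0, lim_{x↓0} ∂q^#/∂x (t,x,y) = lim_{x↑0} ∂q^#/∂x (t,x,y), where q^#(t,x,y) := p^{(α^#)}(t, s⁻¹(x), s⁻¹(y)) / √(D(y)); moreover lim_{x↓0} q^#(t,x,y) = lim_{x↑0} q^#(t,x,y), and ∂q^#/∂t (t,x,y) = (1/2)·D(x)·∂²q^#/∂x² (t,x,y) for every x ≠ 0. -/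

import Mathlib

open MeasureTheory Real Filter Topology

/-- The Gaussian heat kernel on `ℝ`. -/
noncomputable def gaussKernel (t z : ℝ) : ℝ :=
  (Real.sqrt (2 * Real.pi * t))⁻¹ * Real.exp (-z ^ 2 / (2 * t))

/-- The transition density of `α`-skew Brownian motion. -/
noncomputable def pSkew (α t x y : ℝ) : ℝ :=
  if 0 < x ∧ 0 < y then gaussKernel t (y - x) + (2 * α - 1) * gaussKernel t (y + x)
  else if x < 0 ∧ y ≤ 0 then gaussKernel t (y - x) - (2 * α - 1) * gaussKernel t (y + x)
  else if x ≤ 0 ∧ 0 < y then 2 * α * gaussKernel t (y - x)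
  else 2 * (1 - α) * gaussKernel t (y - x)

/-- The piecewise constant diffusion coefficient: `D⁺` for `x > 0`,
`D⁻` for `x ≤ 0`. -/
noncomputable def Dcoef (Dp Dm x : ℝ) : ℝ := if 0 < x then Dp else Dm

/-- The inverse of the rescaling map `s_{√D}`:
`s⁻¹(x) = x / √D⁺` for `x > 0` and `x / √D⁻` for `x ≤ 0`. -/
noncomputable def sInv (Dp Dm x : ℝ) : ℝ :=
  if 0 < x then x / Real.sqrt Dp else x / Real.sqrt Dm

/-- The arrested-topographic-wave kernel: the rescaled skew Brownian motion
density with transmission parameter `α^# = √D⁻/(√D⁺ + √D⁻)`. -/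
noncomputable def qATW (Dp Dm t x y : ℝ) : ℝ :=
  pSkew (Real.sqrt Dm / (Real.sqrt Dp + Real.sqrt Dm)) t
    (sInv Dp Dm x) (sInv Dp Dm y) / Real.sqrt (Dcoef Dp Dm y)

lemma gauss_dz (t z : ℝ) :
    HasDerivAt (fun z => gaussKernel t z) (-(z / t) * gaussKernel t z) z := by
  have h1 : HasDerivAt (fun z : ℝ => -z ^ 2 / (2 * t)) (-(2 * z) / (2 * t)) z := by
    have := ((hasDerivAt_pow 2 z).neg).div_const (2 * t)
    simpa using this
  have h2 := (h1.exp).const_mul ((Real.sqrt (2 * Real.pi * t))⁻¹)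
  unfold gaussKernel
  refine HasDerivAt.congr_deriv h2 ?_
  rw [show -(2 * z) / (2 * t) = -(z / t) by
    rw [neg_div, mul_div_mul_left _ _ (two_ne_zero)]]
  ring

lemma gauss_dt (t z : ℝ) (ht : 0 < t) :
    HasDerivAt (fun s => gaussKernel s z)
      ((1 / 2) * (z ^ 2 / t ^ 2 - 1 / t) * gaussKernel t z) t := by
  have hp : 0 < 2 * Real.pi * t := by positivity
  have h0 : HasDerivAt (fun s : ℝ => 2 * Real.pi * s) (2 * Real.pi) t := by
    simpa using (hasDerivAt_id t).const_mul (2 * Real.pi)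
  have h1 := (h0.sqrt hp.ne').inv (Real.sqrt_pos.2 hp).ne'
  have h2 : HasDerivAt (fun s : ℝ => -z ^ 2 / (2 * s)) (z ^ 2 / (2 * t ^ 2)) t := by
    have h3 : HasDerivAt (fun s : ℝ => 2 * s) 2 t := by
      simpa using (hasDerivAt_id t).const_mul (2 : ℝ)
    have h4 := (hasDerivAt_const t (-z ^ 2)).div h3 (by positivity)
    refine HasDerivAt.congr_deriv h4 ?_
    field_simp
    ring
  have h5 := h1.mul h2.exp
  unfold gaussKernel
  refine HasDerivAt.congr_deriv h5 ?_
  have hs : Real.sqrt (2 * Real.pi * t) ^ 2 = 2 * Real.pi * t := Real.sq_sqrt hp.le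
  have hs0 := (Real.sqrt_pos.2 hp).ne'
  simp only [Pi.inv_apply]
  rw [hs]
  field_simp
  ring

/-- Generic one-sided kernel. -/
noncomputable def FK (A B k Y t x : ℝ) : ℝ :=
  A * gaussKernel t (Y - k * x) + B * gaussKernel t (Y + k * x)

noncomputable def FK1 (A B k Y t x : ℝ) : ℝ :=
  A * (k * ((Y - k * x) / t) * gaussKernel t (Y - k * x)) +
    B * (-k * ((Y + k * x) / t) * gaussKernel t (Y + k * x))

lemma gauss_aff (t Y c x : ℝ) : HasDerivAt (fun x => gaussKernel t (Y + c * x))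
    (-c * ((Y + c * x) / t) * gaussKernel t (Y + c * x)) x := by
  have h0 : HasDerivAt (fun x : ℝ => Y + c * x) c x := by
    simpa using ((hasDerivAt_id x).const_mul c).const_add Y
  have := (gauss_dz t (Y + c * x)).comp x h0
  refine HasDerivAt.congr_deriv this ?_
  ring

lemma gauss_aff2 (t Y c x : ℝ) (ht : 0 < t) :
    HasDerivAt (fun x => -c * ((Y + c * x) / t) * gaussKernel t (Y + c * x))
    (c ^ 2 * ((Y + c * x) ^ 2 / t ^ 2 - 1 / t) * gaussKernel t (Y + c * x)) x := by
  have h0 : HasDerivAt (fun x : ℝ => Y + c * x) c x := by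
    simpa using ((hasDerivAt_id x).const_mul c).const_add Y
  have := ((h0.div_const t).const_mul (-c)).mul (gauss_aff t Y c x)
  refine HasDerivAt.congr_deriv this ?_
  field_simp
  ring

lemma FK_dx (A B k Y t x : ℝ) :
    HasDerivAt (fun x => FK A B k Y t x) (FK1 A B k Y t x) x := by
  have h := ((gauss_aff t Y (-k) x).const_mul A).add ((gauss_aff t Y k x).const_mul B)
  simp only [neg_mul, neg_neg, ← sub_eq_add_neg] at h
  unfold FK FK1
  refine HasDerivAt.congr_deriv h ?_
  ring

lemma FK_pde (A B k Y t x D : ℝ) (ht : 0 < t) (hk : D * k ^ 2 = 1) :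
    deriv (fun s => FK A B k Y s x) t =
      (1 / 2) * D * deriv (fun x => FK1 A B k Y t x) x := by
  have h := ((gauss_aff2 t Y (-k) x ht).const_mul A).add
    ((gauss_aff2 t Y k x ht).const_mul B)
  have e : (fun x => FK1 A B k Y t x) =
      (fun x => A * (- -k * ((Y + -k * x) / t) * gaussKernel t (Y + -k * x)))
      + fun x => B * (-k * ((Y + k * x) / t) * gaussKernel t (Y + k * x)) := by
    funext x
    simp only [FK1, Pi.add_apply, neg_mul, neg_neg, ← sub_eq_add_neg]
  have h' := ((gauss_dt t (Y - k * x) ht).const_mul A).add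
    ((gauss_dt t (Y + k * x) ht).const_mul B)
  have e' : (fun s => FK A B k Y s x) = (fun s => A * gaussKernel s (Y - k * x))
      + fun s => B * gaussKernel s (Y + k * x) := rfl
  rw [e, e', h.deriv, h'.deriv]
  simp only [neg_mul, ← sub_eq_add_neg]
  linear_combination (-(1 / 2) * (A * (((Y - k * x) ^ 2 / t ^ 2 - 1 / t) *
    gaussKernel t (Y - k * x)) + B * (((Y + k * x) ^ 2 / t ^ 2 - 1 / t) *
    gaussKernel t (Y + k * x)))) * hk

lemma gauss_cont (t : ℝ) : Continuous (fun z => gaussKernel t z) := by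
  unfold gaussKernel
  fun_prop

lemma FK_tendsto (A B k Y t : ℝ) (s : Set ℝ) :
    Tendsto (fun x => FK A B k Y t x) (𝓝[s] 0) (𝓝 ((A + B) * gaussKernel t Y)) := by
  have hc : Continuous (fun x => FK A B k Y t x) :=
    continuous_iff_continuousAt.2 fun x => (FK_dx A B k Y t x).continuousAt
  have := (hc.tendsto 0).mono_left (nhdsWithin_le_nhds (s := s))
  convert this using 2
  simp [FK]
  ring

lemma FK1_tendsto (A B k Y t : ℝ) (s : Set ℝ) :
    Tendsto (fun x => FK1 A B k Y t x) (𝓝[s] 0)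
      (𝓝 (((A - B) * k) * (Y / t * gaussKernel t Y))) := by
  have hg := gauss_cont t
  have hc : Continuous (fun x => FK1 A B k Y t x) := by
    have h1 : Continuous fun x => gaussKernel t (Y - k * x) := hg.comp (by fun_prop)
    have h2 : Continuous fun x => gaussKernel t (Y + k * x) := hg.comp (by fun_prop)
    unfold FK1
    fun_prop
  have := (hc.tendsto 0).mono_left (nhdsWithin_le_nhds (s := s))
  convert this using 2
  simp [FK1]
  ring

lemma qATW_repr (Dp Dm : ℝ) (hDp : 0 < Dp) (hDm : 0 < Dm) (y : ℝ) (hy : y ≠ 0) :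
    ∃ Y A B A' B' : ℝ,
      (∀ t x, 0 < x → qATW Dp Dm t x y = FK A B (Real.sqrt Dp)⁻¹ Y t x) ∧
      (∀ t x, x < 0 → qATW Dp Dm t x y = FK A' B' (Real.sqrt Dm)⁻¹ Y t x) ∧
      A + B = A' + B' ∧
      (A - B) * (Real.sqrt Dp)⁻¹ = (A' - B') * (Real.sqrt Dm)⁻¹ := by
  have ha := Real.sqrt_pos.2 hDp
  have hb := Real.sqrt_pos.2 hDm
  unfold qATW sInv Dcoef pSkew FK
  set a := Real.sqrt Dp
  set b := Real.sqrt Dm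
  set α := b / (a + b) with hα
  rcases lt_or_gt_of_ne hy with h | h
  · have hY : y / b < 0 := div_neg_of_neg_of_pos h hb
    refine ⟨y / b, 2 * (1 - α) / b, 0, 1 / b, -(2 * α - 1) / b, ?_, ?_, ?_, ?_⟩
    · intro t x hx
      have hX : 0 < x / a := div_pos hx ha
      simp only [hx, h.not_gt, hY.not_gt, hX, hX.not_gt, hX.not_ge, if_true, if_false,
        and_false, false_and]
      rw [show a⁻¹ * x = x / a by ring]
      ring
    · intro t x hx
      have hX : x / b < 0 := div_neg_of_neg_of_pos hx hb
      simp only [hx.not_gt, h.not_gt, hY.not_gt, hX.not_gt, hX, hY.le, if_true, if_false,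
        and_false, and_self]
      rw [show b⁻¹ * x = x / b by ring]
      ring
    · ring
    · rw [hα]; field_simp; ring
  · have hY : 0 < y / a := div_pos h ha
    refine ⟨y / a, 1 / a, (2 * α - 1) / a, 2 * α / a, 0, ?_, ?_, ?_, ?_⟩
    · intro t x hx
      have hX : 0 < x / a := div_pos hx ha
      simp only [hx, h, hY, hX, if_true, and_self]
      rw [show a⁻¹ * x = x / a by ring]
      ring
    · intro t x hx
      have hX : x / b < 0 := div_neg_of_neg_of_pos hx hb
      simp only [hx.not_gt, h, hY, hX.not_gt, hX, hX.le, hY.not_ge, if_true, if_false,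
        and_false, false_and, and_self]
      rw [show b⁻¹ * x = x / b by ring]
      ring
    · ring
    · rw [hα]; field_simp; ring

/-- for fixed `y ≠ 0`, the arrested-topographic-wave kernel
(the `λ = 1/2` interface condition of coastal upwelling) has a continuously
matching derivative across the interface, is itself continuous across the
interface, and solves the heat equation with coefficient `D(x)/2` away from
the interface. -/
theorem qATW_interface_problem (Dp Dm : ℝ) (hDp : 0 < Dp) (hDm : 0 < Dm)
    (y : ℝ) (hy : y ≠ 0) :
    (∀ t : ℝ, 0 < t → ∃ g : ℝ,
      Filter.Tendsto (deriv (fun x' : ℝ => qATW Dp Dm t x' y))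
        (nhdsWithin 0 (Set.Ioi 0)) (nhds g) ∧
      Filter.Tendsto (deriv (fun x' : ℝ => qATW Dp Dm t x' y))
        (nhdsWithin 0 (Set.Iio 0)) (nhds g)) ∧
    (∀ t : ℝ, 0 < t → ∃ c : ℝ,
      Filter.Tendsto (fun x : ℝ => qATW Dp Dm t x y)
        (nhdsWithin 0 (Set.Ioi 0)) (nhds c) ∧
      Filter.Tendsto (fun x : ℝ => qATW Dp Dm t x y)
        (nhdsWithin 0 (Set.Iio 0)) (nhds c)) ∧
    (∀ t : ℝ, 0 < t → ∀ x : ℝ, x ≠ 0 →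
      deriv (fun s : ℝ => qATW Dp Dm s x y) t =
        (1 / 2) * Dcoef Dp Dm x *
          deriv (deriv (fun x' : ℝ => qATW Dp Dm t x' y)) x) := by
  obtain ⟨Y, A, B, A', B', hp, hm, hc, hd⟩ := qATW_repr Dp Dm hDp hDm y hy
  have dp : ∀ t x, 0 < x → deriv (fun x' : ℝ => qATW Dp Dm t x' y) x =
      FK1 A B (Real.sqrt Dp)⁻¹ Y t x := by
    intro t x hx
    have : (fun x' : ℝ => qATW Dp Dm t x' y) =ᶠ[𝓝 x]
        fun x' => FK A B (Real.sqrt Dp)⁻¹ Y t x' := by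
      filter_upwards [Ioi_mem_nhds hx] with z hz using hp t z hz
    rw [this.deriv_eq, (FK_dx _ _ _ _ _ _).deriv]
  have dm : ∀ t x, x < 0 → deriv (fun x' : ℝ => qATW Dp Dm t x' y) x =
      FK1 A' B' (Real.sqrt Dm)⁻¹ Y t x := by
    intro t x hx
    have : (fun x' : ℝ => qATW Dp Dm t x' y) =ᶠ[𝓝 x]
        fun x' => FK A' B' (Real.sqrt Dm)⁻¹ Y t x' := by
      filter_upwards [Iio_mem_nhds hx] with z hz using hm t z hz
    rw [this.deriv_eq, (FK_dx _ _ _ _ _ _).deriv]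
  refine ⟨fun t ht => ⟨((A - B) * (Real.sqrt Dp)⁻¹) * (Y / t * gaussKernel t Y), ?_, ?_⟩,
    fun t ht => ⟨(A + B) * gaussKernel t Y, ?_, ?_⟩, fun t ht x hx => ?_⟩
  · refine (FK1_tendsto A B _ Y t _).congr' ?_
    filter_upwards [self_mem_nhdsWithin] with z hz using (dp t z hz).symm
  · rw [hd]
    refine (FK1_tendsto A' B' _ Y t _).congr' ?_
    filter_upwards [self_mem_nhdsWithin] with z hz using (dm t z hz).symm
  · refine (FK_tendsto A B (Real.sqrt Dp)⁻¹ Y t _).congr' ?_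
    filter_upwards [self_mem_nhdsWithin] with z hz using (hp t z hz).symm
  · rw [hc]
    refine (FK_tendsto A' B' (Real.sqrt Dm)⁻¹ Y t _).congr' ?_
    filter_upwards [self_mem_nhdsWithin] with z hz using (hm t z hz).symm
  · rcases lt_or_gt_of_ne hx with h | h
    · have e : deriv (fun x' : ℝ => qATW Dp Dm t x' y) =ᶠ[𝓝 x]
          fun x' => FK1 A' B' (Real.sqrt Dm)⁻¹ Y t x' := by
        filter_upwards [Iio_mem_nhds h] with z hz using dm t z hz
      rw [e.deriv_eq, funext fun s => hm s x h, Dcoef, if_neg h.not_gt]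
      refine FK_pde _ _ _ _ _ _ _ ht ?_
      rw [inv_pow, Real.sq_sqrt hDm.le, mul_inv_cancel₀ hDm.ne']
    · have e : deriv (fun x' : ℝ => qATW Dp Dm t x' y) =ᶠ[𝓝 x]
          fun x' => FK1 A B (Real.sqrt Dp)⁻¹ Y t x' := by
        filter_upwards [Ioi_mem_nhds h] with z hz using dp t z hz
      rw [e.deriv_eq, funext fun s => hp s x h, Dcoef, if_pos h]
      refine FK_pde _ _ _ _ _ _ _ ht ?_
      rw [inv_pow, Real.sq_sqrt hDp.le, mul_inv_cancel₀ hDp.ne']
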